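/- If γ := λ_{H_F,s} − δ_{F_s}/2 > 0 and ℓ := L_{H_F,s} + δ_{F_s}/2, then for every w ∈ U the two-sided Polyak–Łojasiewicz-type inequality holds: (1/(2ℓ))‖∇f(w)‖²_{F_s^†(w)} ≤ f(w) − f(Φ(w)) ≤ (1/(2γ))‖∇f(w)‖²_{F_s^†(w)}. -/

import Mathlib

open Matrix Set Filter

/-- Entrywise directional derivative `∇A(w)[v]` of a matrix-valued map. -/
noncomputable def matDeriv {p : ℕ} (A : (Fin p → ℝ) → Matrix (Fin p) (Fin p) ℝ)
    (w v : Fin p → ℝ) : Matrix (Fin p) (Fin p) ℝ :=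
  fun i j => fderiv ℝ (fun x => A x i j) w v

/-- Euclidean gradient `∇f(w)`. -/
noncomputable def gradVec {p : ℕ} (f : (Fin p → ℝ) → ℝ) (w : Fin p → ℝ) : Fin p → ℝ :=
  fun j => fderiv ℝ f w (Pi.single j 1)

/-- Euclidean Hessian `∇²f(w)`. -/
noncomputable def hessMat {p : ℕ} (f : (Fin p → ℝ) → ℝ) (w : Fin p → ℝ) :
    Matrix (Fin p) (Fin p) ℝ :=
  fun i j => fderiv ℝ (fun x => fderiv ℝ f x (Pi.single j 1)) w (Pi.single i 1)

/-- `‖v‖_M = √(vᵀ M v)`. -/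
noncomputable def mnorm {p : ℕ} (M : Matrix (Fin p) (Fin p) ℝ) (v : Fin p → ℝ) : ℝ :=
  Real.sqrt (v ⬝ᵥ M *ᵥ v)

open scoped Matrix.Norms.Operator in
theorem hasDerivAt_matrix_inv_apply {p : ℕ} {A : ℝ → Matrix (Fin p) (Fin p) ℝ}
    {A' : Matrix (Fin p) (Fin p) ℝ} {t : ℝ}
    (hA : ∀ i j, HasDerivAt (fun s => A s i j) (A' i j) t) (hu : IsUnit (A t)) (i j : Fin p) :
    HasDerivAt (fun s => (A s)⁻¹ i j) (-((A t)⁻¹ * A' * (A t)⁻¹) i j) t := by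
  have hAt : HasDerivAt A A' t := hasDerivAt_pi.2 fun i => hasDerivAt_pi.2 fun j => hA i j
  obtain ⟨u, hu⟩ := hu
  have hinv := hasFDerivAt_ringInverse (𝕜 := ℝ) u
  rw [hu] at hinv
  have hentry := hasDerivAt_pi.1 (hasDerivAt_pi.1 (hinv.comp_hasDerivAt t hAt) i) j
  simpa [← Matrix.nonsing_inv_eq_ringInverse, ← hu, Matrix.coe_units_inv] using hentry

theorem HasDerivAt.dotProduct_of_apply {p : ℕ} {x y : ℝ → Fin p → ℝ} {x' y' : Fin p → ℝ} {t : ℝ}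
    (hx : ∀ i, HasDerivAt (fun s => x s i) (x' i) t)
    (hy : ∀ i, HasDerivAt (fun s => y s i) (y' i) t) :
    HasDerivAt (fun s => x s ⬝ᵥ y s) (x' ⬝ᵥ y t + x t ⬝ᵥ y') t := by
  simp only [dotProduct, ← Finset.sum_add_distrib]
  exact HasDerivAt.fun_sum fun i _ => (hx i).mul (hy i)

theorem HasDerivAt.mulVec_of_apply {p : ℕ} {A : ℝ → Matrix (Fin p) (Fin p) ℝ}
    {A' : Matrix (Fin p) (Fin p) ℝ} {x : ℝ → Fin p → ℝ} {x' : Fin p → ℝ} {t : ℝ}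
    (hA : ∀ i j, HasDerivAt (fun s => A s i j) (A' i j) t)
    (hx : ∀ i, HasDerivAt (fun s => x s i) (x' i) t) (i : Fin p) :
    HasDerivAt (fun s => (A s *ᵥ x s) i) ((A' *ᵥ x t + A t *ᵥ x') i) t :=
  HasDerivAt.dotProduct_of_apply (hA i) hx

theorem Matrix.PosDef.abs_dotProduct_le_mnorm {p : ℕ} {F : Matrix (Fin p) (Fin p) ℝ}
    (hF : F.PosDef) (a b : Fin p → ℝ) : |a ⬝ᵥ b| ≤ mnorm F⁻¹ a * mnorm F b := by
  have hFT : Fᵀ = F := by simpa using hF.isHermitian.eq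
  have hunit : IsUnit F.det := (Matrix.isUnit_iff_isUnit_det F).1 hF.isUnit
  have hinv (x : Fin p → ℝ) : 0 ≤ x ⬝ᵥ F⁻¹ *ᵥ x := by
    simpa using hF.inv.posSemidef.dotProduct_mulVec_nonneg x
  have hquad (s : ℝ) :
      0 ≤ (b ⬝ᵥ F *ᵥ b) * (s * s) + (-2 * (a ⬝ᵥ b)) * s + a ⬝ᵥ F⁻¹ *ᵥ a := by
    have h := hinv (a - s • F *ᵥ b)
    have hcancel : F⁻¹ *ᵥ F *ᵥ b = b := by
      rw [mulVec_mulVec, nonsing_inv_mul _ hunit, one_mulVec]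
    have hcross : (F *ᵥ b) ⬝ᵥ F⁻¹ *ᵥ a = a ⬝ᵥ b := by
      rw [dotProduct_mulVec, ← mulVec_transpose, transpose_nonsing_inv, hFT, hcancel,
        dotProduct_comm]
    simp only [mulVec_sub, mulVec_smul, sub_dotProduct, dotProduct_sub, smul_dotProduct,
      dotProduct_smul, hcancel, hcross, smul_eq_mul] at h
    rw [dotProduct_comm (F *ᵥ b) b] at h
    linarith
  have hdisc := discrim_le_zero hquad
  rw [discrim] at hdisc
  rw [mnorm, mnorm, ← Real.sqrt_mul (hinv a)]
  exact Real.abs_le_sqrt (by linarith)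

/-- The derivative of `gᵀ P F⁻¹ P g` along a curve on which `g`, `P`, `F` have derivatives
`g'`, `P'`, `F'`. -/
theorem hasDerivAt_sharp_form {p : ℕ} {P F : ℝ → Matrix (Fin p) (Fin p) ℝ} {g : ℝ → Fin p → ℝ}
    {P' F' : Matrix (Fin p) (Fin p) ℝ} {g' : Fin p → ℝ} {t : ℝ}
    (hP : ∀ i j, HasDerivAt (fun s => P s i j) (P' i j) t)
    (hF : ∀ i j, HasDerivAt (fun s => F s i j) (F' i j) t)
    (hg : ∀ i, HasDerivAt (fun s => g s i) (g' i) t)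
    (hpos : (F t).PosDef) (hPT : (P t)ᵀ = P t) (hPT' : P'ᵀ = P')
    (hcomm : P t * F t = F t * P t) (hproj : P t * P t = P t)
    {v : Fin p → ℝ} (hv : v = (P t * (F t)⁻¹ * P t) *ᵥ g t) :
    HasDerivAt (fun s => g s ⬝ᵥ (P s * (F s)⁻¹ * P s) *ᵥ g s)
      (2 * (g' ⬝ᵥ v) + 2 * (g t ⬝ᵥ P' *ᵥ v) - v ⬝ᵥ F' *ᵥ v) t := by
  have hFT : (F t)ᵀ = F t := by simpa using hpos.isHermitian.eq
  have hunit : IsUnit (F t).det := (Matrix.isUnit_iff_isUnit_det _).1 hpos.isUnit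
  have hinv := hasDerivAt_matrix_inv_apply hF hpos.isUnit
  have hmain := HasDerivAt.dotProduct_of_apply hg
    (HasDerivAt.mulVec_of_apply hP
      (HasDerivAt.mulVec_of_apply (A' := -((F t)⁻¹ * F' * (F t)⁻¹)) hinv
        (HasDerivAt.mulVec_of_apply hP hg)))
  simp only [mulVec_mulVec, ← mul_assoc] at hmain
  have hcomm' : P t * (F t)⁻¹ = (F t)⁻¹ * P t := by
    calc P t * (F t)⁻¹ = (F t)⁻¹ * (F t * P t) * (F t)⁻¹ := by
          rw [← mul_assoc, nonsing_inv_mul _ hunit, one_mul]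
      _ = (F t)⁻¹ * P t := by
          rw [← hcomm, mul_assoc, mul_assoc, mul_nonsing_inv _ hunit, mul_one]
  have hv' : v = ((F t)⁻¹ * P t) *ᵥ g t := by
    rw [hv, hcomm', mul_assoc, hproj]
  have hmove (x : Fin p → ℝ) : g t ⬝ᵥ P t *ᵥ (F t)⁻¹ *ᵥ x = v ⬝ᵥ x := by
    rw [mulVec_mulVec, dotProduct_mulVec, ← mulVec_transpose, transpose_mul, transpose_nonsing_inv, hFT, hPT, hv']
  convert hmain using 1
  have hP'v : (P' * (F t)⁻¹ * P t) *ᵥ g t = P' *ᵥ v := by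
    rw [hv', mulVec_mulVec, mul_assoc]
  have hF'v : (-((F t)⁻¹ * F' * (F t)⁻¹) * P t) *ᵥ g t = -((F t)⁻¹ *ᵥ F' *ᵥ v) := by
    simp only [hv', mulVec_mulVec, ← neg_mulVec, neg_mul, mul_assoc]
  have hP'g : v ⬝ᵥ P' *ᵥ g t = g t ⬝ᵥ P' *ᵥ v := by
    rw [dotProduct_mulVec, ← mulVec_transpose, hPT', dotProduct_comm]
  have hPg' : v ⬝ᵥ P t *ᵥ g' = g' ⬝ᵥ v := by
    rw [dotProduct_mulVec, ← mulVec_transpose, hPT, dotProduct_comm, hv, mulVec_mulVec,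
      ← mul_assoc, ← mul_assoc, hproj]
  rw [← hv, hP'v, hF'v, mulVec_add, mulVec_neg, dotProduct_add, dotProduct_add,
    dotProduct_neg, hmove, hmove, dotProduct_add, hP'g, hPg']
  ring

/-- Comparison along a gradient-like flow: `φ' = -q` with `q'` between `-2ℓq` and `-2γq`. -/
theorem gap_bounds_of_hasDerivAt {φ q D : ℝ → ℝ} {γ ℓ φlim : ℝ} (hγ : 0 < γ)
    (hφ : ∀ t, 0 ≤ t → HasDerivAt φ (-q t) t) (hq : ∀ t, 0 ≤ t → HasDerivAt q (D t) t)
    (hq0 : ∀ t, 0 ≤ t → 0 ≤ q t) (hD : ∀ t, 0 ≤ t → D t ≤ -(2 * γ) * q t)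
    (hD' : ∀ t, 0 ≤ t → -(2 * ℓ) * q t ≤ D t) (hlim : Tendsto φ atTop (nhds φlim)) :
    φlim ≤ φ 0 ∧ q 0 ≤ 2 * ℓ * (φ 0 - φlim) ∧ 2 * γ * (φ 0 - φlim) ≤ q 0 := by
  have hanti {h h' : ℝ → ℝ} (hh : ∀ t, 0 ≤ t → HasDerivAt h (h' t) t)
      (hn : ∀ t, 0 ≤ t → h' t ≤ 0) (t : ℝ) (ht : 0 ≤ t) : h t ≤ h 0 := by
    refine antitoneOn_of_deriv_nonpos (convex_Ici 0)
      (fun x hx => (hh x hx).continuousAt.continuousWithinAt)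
      (fun x hx => (hh x (interior_subset hx)).differentiableAt.differentiableWithinAt)
      (fun x hx => ?_) self_mem_Ici ht ht
    rw [(hh x (interior_subset hx)).deriv]
    exact hn x (interior_subset hx)
  have hev : ∀ᶠ t : ℝ in atTop, 0 ≤ t := eventually_ge_atTop 0
  have hdecay (t : ℝ) (ht : 0 ≤ t) : Real.exp (2 * γ * t) * q t ≤ q 0 := by
    have h := hanti (h := fun t => Real.exp (2 * γ * t) * q t)
      (h' := fun t => Real.exp (2 * γ * t) * (2 * γ) * q t + Real.exp (2 * γ * t) * D t)
      (fun t ht => (by simpa using ((hasDerivAt_id t).const_mul (2 * γ)).exp :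
        HasDerivAt (fun t => Real.exp (2 * γ * t)) (Real.exp (2 * γ * t) * (2 * γ)) t).mul (hq t ht))
      (fun t ht => by nlinarith [hD t ht, Real.exp_pos (2 * γ * t)]) t ht
    simpa using h
  have hqlim : Tendsto q atTop (nhds 0) := by
    have hexp : Tendsto (fun t : ℝ => q 0 * Real.exp (-(2 * γ * t))) atTop (nhds (q 0 * 0)) :=
      (Real.tendsto_exp_neg_atTop_nhds_zero.comp
        (tendsto_id.const_mul_atTop (by positivity : 0 < 2 * γ))).const_mul _
    rw [mul_zero] at hexp
    refine squeeze_zero' (hev.mono hq0) (hev.mono fun t ht => ?_) hexp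
    rw [Real.exp_neg, ← div_eq_mul_inv, le_div_iff₀ (Real.exp_pos _), mul_comm]
    exact hdecay t ht
  refine ⟨?_, ?_, ?_⟩
  · exact le_of_tendsto hlim
      (hev.mono (hanti hφ fun t ht => by linarith [hq0 t ht]))
  · have h := le_of_tendsto ((hlim.const_mul (2 * ℓ)).sub hqlim)
      (hev.mono (hanti (fun t ht => ((hφ t ht).const_mul (2 * ℓ)).sub (hq t ht))
        fun t ht => by linarith [hD' t ht]))
    linarith
  · have h := le_of_tendsto (hqlim.sub (hlim.const_mul (2 * γ)))
      (hev.mono (hanti (fun t ht => (hq t ht).sub ((hφ t ht).const_mul (2 * γ)))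
        fun t ht => by linarith [hD t ht]))
    linarith

theorem ContinuousLinearMap.apply_eq_dotProduct_single {p : ℕ} (φ : (Fin p → ℝ) →L[ℝ] ℝ)
    (u : Fin p → ℝ) : φ u = u ⬝ᵥ fun i => φ (Pi.single i 1) := by
  conv_lhs => rw [pi_eq_sum_univ' u, map_sum]
  simp [dotProduct]

theorem HasDerivAt.comp_of_contDiffAt_apply {p : ℕ} {A : (Fin p → ℝ) → Matrix (Fin p) (Fin p) ℝ}
    {c : ℝ → Fin p → ℝ} {u : Fin p → ℝ} {t : ℝ}
    (hA : ∀ i j, ContDiffAt ℝ (⊤ : ℕ∞) (fun x => A x i j) (c t)) (hc : HasDerivAt c u t)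
    (i j : Fin p) : HasDerivAt (fun s => A (c s) i j) (matDeriv A (c t) u i j) t :=
  ((hA i j).differentiableAt (by simp)).hasFDerivAt.comp_hasDerivAt t hc

theorem hasDerivAt_comp_gradVec {p : ℕ} {f : (Fin p → ℝ) → ℝ} {c : ℝ → Fin p → ℝ}
    {u : Fin p → ℝ} {t : ℝ} (hf : AnalyticAt ℝ f (c t)) (hc : HasDerivAt c u t) (j : Fin p) :
    HasDerivAt (fun s => gradVec f (c s) j) ((u ᵥ* hessMat f (c t)) j) t := by
  have hd : DifferentiableAt ℝ (fun x => fderiv ℝ f x (Pi.single j 1)) (c t) :=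
    hf.fderiv.differentiableAt.clm_apply (differentiableAt_const _)
  exact (hd.hasFDerivAt.comp_hasDerivAt t hc).congr_deriv
    (ContinuousLinearMap.apply_eq_dotProduct_single _ u)

theorem matDeriv_transpose {p : ℕ} {U : Set (Fin p → ℝ)} (hU : IsOpen U)
    {P : (Fin p → ℝ) → Matrix (Fin p) (Fin p) ℝ} (hP : ∀ w ∈ U, (P w)ᵀ = P w)
    {w : Fin p → ℝ} (hw : w ∈ U) (u : Fin p → ℝ) : (matDeriv P w u)ᵀ = matDeriv P w u := by
  ext i j
  have h : (fun x => P x j i) =ᶠ[nhds w] fun x => P x i j :=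
    Filter.eventually_of_mem (hU.mem_nhds hw) fun x hx => congrFun₂ (hP x hx) i j
  simp only [matDeriv, transpose_apply, h.fderiv_eq]

/-- The bound on the error terms in the derivative of the sharp form, where `P'` and `F'` are
directional derivatives along `-v`. -/
theorem abs_sharp_error_le {p : ℕ} {F P' F' : Matrix (Fin p) (Fin p) ℝ} {g v : Fin p → ℝ}
    {G δ δF : ℝ} (hF : F.PosDef) (hG : 0 < G) (hδF : 0 ≤ δF)
    (hg : mnorm F⁻¹ g ≤ G) (hgv : g ⬝ᵥ v = v ⬝ᵥ F *ᵥ v)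
    (hP' : mnorm F (P' *ᵥ v) ≤ δ / G * (mnorm F v * mnorm F v))
    (hF' : mnorm F⁻¹ (F' *ᵥ v) ≤ δF / G * (mnorm F v * mnorm F v)) :
    |2 * (g ⬝ᵥ P' *ᵥ v) - v ⬝ᵥ F' *ᵥ v| ≤ (2 * δ + δF) * (v ⬝ᵥ F *ᵥ v) := by
  have hvF : 0 ≤ v ⬝ᵥ F *ᵥ v := by simpa using hF.posSemidef.dotProduct_mulVec_nonneg v
  have hsq : mnorm F v * mnorm F v = v ⬝ᵥ F *ᵥ v := Real.mul_self_sqrt hvF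
  have hn : 0 ≤ mnorm F v := Real.sqrt_nonneg _
  have hvG : mnorm F v ≤ G := by
    by_contra! hlt
    have h := (le_abs_self _).trans (hF.abs_dotProduct_le_mnorm g v)
    rw [hgv, ← hsq] at h
    nlinarith [hG.trans hlt]
  rw [hsq] at hP' hF'
  have h₁ : |g ⬝ᵥ P' *ᵥ v| ≤ δ * (v ⬝ᵥ F *ᵥ v) :=
    calc |g ⬝ᵥ P' *ᵥ v| ≤ mnorm F⁻¹ g * mnorm F (P' *ᵥ v) := hF.abs_dotProduct_le_mnorm _ _
      _ ≤ G * (δ / G * (v ⬝ᵥ F *ᵥ v)) := mul_le_mul hg hP' (Real.sqrt_nonneg _) hG.le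
      _ = δ * (v ⬝ᵥ F *ᵥ v) := by field_simp
  have h₂ : |v ⬝ᵥ F' *ᵥ v| ≤ δF * (v ⬝ᵥ F *ᵥ v) :=
    calc |v ⬝ᵥ F' *ᵥ v| ≤ mnorm F⁻¹ (F' *ᵥ v) * mnorm F v := by
          rw [dotProduct_comm]; exact hF.abs_dotProduct_le_mnorm _ _
      _ ≤ (δF / G * (v ⬝ᵥ F *ᵥ v)) * G := mul_le_mul hF' hvG hn (by positivity)
      _ = δF * (v ⬝ᵥ F *ᵥ v) := by field_simp
  rw [abs_le] at *
  constructor <;> linarith [h₁.1, h₁.2, h₂.1, h₂.2]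

theorem mnorm_neg {p : ℕ} (M : Matrix (Fin p) (Fin p) ℝ) (v : Fin p → ℝ) :
    mnorm M (-v) = mnorm M v := by
  simp [mnorm, mulVec_neg]

/-- For an orthogonal projection `P` commuting with `F`, the vector `v = P F⁻¹ P g` lies in the
range of `P` and `vᵀ F v = gᵀ v`. -/
theorem sharp_direction {p : ℕ} {P F : Matrix (Fin p) (Fin p) ℝ} {g v : Fin p → ℝ}
    (hF : F.PosDef) (hPT : Pᵀ = P) (hcomm : P * F = F * P) (hproj : P * P = P)
    (hv : v = (P * F⁻¹ * P) *ᵥ g) : P *ᵥ v = v ∧ g ⬝ᵥ v = v ⬝ᵥ F *ᵥ v := by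
  have hFT : Fᵀ = F := by simpa using hF.isHermitian.eq
  have hunit : IsUnit F.det := (Matrix.isUnit_iff_isUnit_det _).1 hF.isUnit
  have hPv : P *ᵥ v = v := by
    rw [hv, mulVec_mulVec, ← mul_assoc, ← mul_assoc, hproj]
  refine ⟨hPv, ?_⟩
  have hFv : F *ᵥ v = P *ᵥ g := by
    rw [hv, mulVec_mulVec, ← mul_assoc, ← mul_assoc, ← hcomm, mul_assoc P F,
      mul_nonsing_inv _ hunit, mul_one, hproj]
  rw [hFv, dotProduct_mulVec, ← mulVec_transpose, hPT, hPv, dotProduct_comm]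

/-- Two-sided Polyak–Łojasiewicz-type inequality along the sharp directions:
with `γ = λ_{H_F,s} − δ_{F_s}/2 > 0` and `ℓ = L_{H_F,s} + δ_{F_s}/2`,
`(1/(2ℓ))‖∇f(w)‖²_{F_s†(w)} ≤ f(w) − f(Φ(w)) ≤ (1/(2γ))‖∇f(w)‖²_{F_s†(w)}`. -/
theorem PL_inequality_to_river
    {p : ℕ} (U : Set (Fin p → ℝ)) (hU : IsOpen U)
    (F Ps : (Fin p → ℝ) → Matrix (Fin p) (Fin p) ℝ)
    (f : (Fin p → ℝ) → ℝ)
    (G δ δF : ℝ) (hG : 0 < G) (hδ : 0 ≤ δ) (hδF : 0 ≤ δF)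
    (hFsmooth : ∀ i j, ContDiff ℝ (⊤ : ℕ∞) fun w => F w i j)
    (hFpos : ∀ w, (F w).PosDef)
    (hfan : AnalyticOnNhd ℝ f U)
    (hPssmooth : ∀ w ∈ U, ∀ i j, ContDiffAt ℝ (⊤ : ℕ∞) (fun x => Ps x i j) w)
    (hPsproj : ∀ w ∈ U, Ps w * Ps w = Ps w)
    (hPssymm : ∀ w ∈ U, (Ps w)ᵀ = Ps w)
    (hcomm : ∀ w ∈ U, Ps w * F w = F w * Ps w)
    (hgradG : ∀ w ∈ U, mnorm ((F w)⁻¹) (gradVec f w) ≤ G)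
    (hPsb : ∀ w ∈ U, ∀ u v : Fin p → ℝ,
      mnorm (F w) (matDeriv Ps w u *ᵥ v) ≤ δ / G * (mnorm (F w) u * mnorm (F w) v))
    (hFb : ∀ w ∈ U, ∀ u v : Fin p → ℝ,
      mnorm ((F w)⁻¹) (matDeriv F w u *ᵥ v) ≤ δF / G * (mnorm (F w) u * mnorm (F w) v))
    (lamHFs LHFs : ℝ) (hlamHFs : 0 < lamHFs)
    (hHFs : ∀ w ∈ U, ∀ v : Fin p → ℝ, Ps w *ᵥ v = v →
      lamHFs * (v ⬝ᵥ F w *ᵥ v) ≤ v ⬝ᵥ hessMat f w *ᵥ v ∧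
      v ⬝ᵥ hessMat f w *ᵥ v ≤ LHFs * (v ⬝ᵥ F w *ᵥ v))
    (ψ : ℝ → (Fin p → ℝ) → Fin p → ℝ)
    (hψ0 : ∀ w ∈ U, ψ 0 w = w)
    (hψU : ∀ w ∈ U, ∀ t : ℝ, 0 ≤ t → ψ t w ∈ U)
    (hψode : ∀ w ∈ U, ∀ t : ℝ, 0 ≤ t →
      HasDerivAt (fun s => ψ s w)
        (-((Ps (ψ t w) * (F (ψ t w))⁻¹ * Ps (ψ t w)) *ᵥ gradVec f (ψ t w))) t)
    (Φ : (Fin p → ℝ) → Fin p → ℝ)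
    (hΦlim : ∀ w ∈ U, Tendsto (fun t => ψ t w) atTop (nhds (Φ w)))
    (hΦU : ∀ w ∈ U, Φ w ∈ U)
    (hγ : 0 < lamHFs - (2 * δ + δF) / 2) :
    ∀ w ∈ U,
      1 / (2 * (LHFs + (2 * δ + δF) / 2))
          * (mnorm (Ps w * (F w)⁻¹ * Ps w) (gradVec f w)) ^ 2
        ≤ f w - f (Φ w) ∧
      f w - f (Φ w)
        ≤ 1 / (2 * (lamHFs - (2 * δ + δF) / 2))
          * (mnorm (Ps w * (F w)⁻¹ * Ps w) (gradVec f w)) ^ 2 := by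
  intro w hw
  set c : ℝ → Fin p → ℝ := fun t => ψ t w with hc
  have hcU (t : ℝ) (ht : 0 ≤ t) : c t ∈ U := hψU w hw t ht
  set v : ℝ → Fin p → ℝ := fun t =>
    (Ps (c t) * (F (c t))⁻¹ * Ps (c t)) *ᵥ gradVec f (c t) with hv
  set q : ℝ → ℝ := fun t => gradVec f (c t) ⬝ᵥ v t with hqdef
  have hode (t : ℝ) (ht : 0 ≤ t) : HasDerivAt c (-v t) t := hψode w hw t ht
  have hsharp (t : ℝ) (ht : 0 ≤ t) : Ps (c t) *ᵥ v t = v t ∧ q t = v t ⬝ᵥ F (c t) *ᵥ v t :=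
    sharp_direction (hFpos _) (hPssymm _ (hcU t ht)) (hcomm _ (hcU t ht))
      (hPsproj _ (hcU t ht)) rfl
  have hq0 (t : ℝ) (ht : 0 ≤ t) : 0 ≤ q t := by
    rw [(hsharp t ht).2]
    simpa using (hFpos (c t)).posSemidef.dotProduct_mulVec_nonneg (v t)
  have hφ (t : ℝ) (ht : 0 ≤ t) : HasDerivAt (fun s => f (c s)) (-q t) t := by
    refine ((hfan _ (hcU t ht)).differentiableAt.hasFDerivAt.comp_hasDerivAt t
      (hode t ht)).congr_deriv ?_
    rw [ContinuousLinearMap.apply_eq_dotProduct_single, neg_dotProduct, dotProduct_comm]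
    rfl
  let D : ℝ → ℝ := fun t =>
    2 * ((-v t ᵥ* hessMat f (c t)) ⬝ᵥ v t)
      + 2 * (gradVec f (c t) ⬝ᵥ matDeriv Ps (c t) (-v t) *ᵥ v t)
      - v t ⬝ᵥ matDeriv F (c t) (-v t) *ᵥ v t
  have hq (t : ℝ) (ht : 0 ≤ t) : HasDerivAt q (D t) t :=
    have hmem := hcU t ht
    hasDerivAt_sharp_form
      (HasDerivAt.comp_of_contDiffAt_apply (hPssmooth _ hmem) (hode t ht))
      (HasDerivAt.comp_of_contDiffAt_apply (fun i j => (hFsmooth i j).contDiffAt) (hode t ht))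
      (hasDerivAt_comp_gradVec (hfan _ hmem) (hode t ht)) (hFpos _) (hPssymm _ hmem)
      (matDeriv_transpose hU hPssymm hmem _) (hcomm _ hmem) (hPsproj _ hmem) rfl
  have hbound (t : ℝ) (ht : 0 ≤ t) :
      |D t + 2 * (v t ⬝ᵥ hessMat f (c t) *ᵥ v t)| ≤ (2 * δ + δF) * q t := by
    have hmem := hcU t ht
    have hP := hPsb _ hmem (-v t) (v t)
    have hF := hFb _ hmem (-v t) (v t)
    rw [mnorm_neg] at hP hF
    have h := abs_sharp_error_le (hFpos _) hG hδF (hgradG _ hmem) (hsharp t ht).2 hP hF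
    rw [← (hsharp t ht).2] at h
    convert h using 2
    simp only [D, neg_vecMul, neg_dotProduct, ← dotProduct_mulVec]
    ring
  have hhess (t : ℝ) (ht : 0 ≤ t) := hHFs _ (hcU t ht) _ (hsharp t ht).1
  have hc0 : c 0 = w := hψ0 w hw
  have hlim : Tendsto (fun t => f (c t)) atTop (nhds (f (Φ w))) :=
    (hfan _ (hΦU w hw)).continuousAt.tendsto.comp (hΦlim w hw)
  obtain ⟨hle, hlower, hupper⟩ := gap_bounds_of_hasDerivAt (D := D)
    (ℓ := LHFs + (2 * δ + δF) / 2) hγ hφ hq hq0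
    (fun t ht => by
      have h := (hhess t ht).1
      rw [← (hsharp t ht).2] at h
      linarith [(abs_le.1 (hbound t ht)).2])
    (fun t ht => by
      have h := (hhess t ht).2
      rw [← (hsharp t ht).2] at h
      linarith [(abs_le.1 (hbound t ht)).1]) hlim
  have hnorm : mnorm (Ps w * (F w)⁻¹ * Ps w) (gradVec f w) ^ 2 = q 0 := by
    have h := hq0 0 le_rfl
    simp only [hqdef, hv, hc0] at h ⊢
    exact Real.sq_sqrt h
  rw [hnorm]
  simp only [hc0] at hle hlower hupper
  refine ⟨?_, ?_⟩
  · rcases (hq0 0 le_rfl).eq_or_lt with hzero | hpos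
    · rw [← hzero, mul_zero]
      linarith
    · have hL : lamHFs ≤ LHFs := by
        have h := (hhess 0 le_rfl).1.trans (hhess 0 le_rfl).2
        rw [← (hsharp 0 le_rfl).2] at h
        exact le_of_mul_le_mul_right h hpos
      rw [one_div_mul_eq_div, div_le_iff₀' (by linarith)]
      exact hlower
  · rw [one_div_mul_eq_div, le_div_iff₀' (by linarith)]
    exact hupper
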